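/- arXiv:1212.6894 — 2 statements merged into one kernel-verified Lean document; each statement's English description precedes it below -/
import Mathlib

section
/- Let k be a field of characteristic zero and (R,𝔪) a Noetherian local k-algebra which is a unique factorization domain of Krull dimension 2. Let m ≤ n and A ∈ Mat(m,n;𝔪). Suppose there exist two injections g₁, g₂ : {1,…,m} → {1,…,n} such that the corresponding maximal minors Δ₁ = det(A on the columns selected by g₁) and Δ₂ = det(A on the columns selected by g₂) are relatively prime in R, i.e. every common divisor of Δ₁ and Δ₂ is a unit. Then A is finitely-G_r-determined. -/
open IsLocalRing

/-- In a local UFD of dimension at most two, a pair of elements without common nonunit divisors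
generates an ideal containing a power of the maximal ideal. -/
theorem exists_maximalIdeal_pow_le_span_pair {R : Type*} [CommRing R] [IsNoetherianRing R]
    [IsLocalRing R] [IsDomain R] [UniqueFactorizationMonoid R] (hdim : ringKrullDim R ≤ 2)
    {a b : R} (hab : ∀ d : R, d ∣ a → d ∣ b → IsUnit d) :
    ∃ N : ℕ, maximalIdeal R ^ N ≤ Ideal.span {a, b} := by
  have hrad : maximalIdeal R ≤ (Ideal.span {a, b}).radical := by
    rw [Ideal.radical_eq_sInf]
    refine le_sInf ?_
    rintro P ⟨hIP, hP⟩
    have haP : a ∈ P := hIP (Ideal.subset_span (by simp))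
    have hbP : b ∈ P := hIP (Ideal.subset_span (by simp))
    have hP0 : P ≠ ⊥ := by
      rintro rfl
      rw [Ideal.mem_bot] at haP hbP
      exact not_isUnit_zero (hab 0 (by simp [haP]) (by simp [hbP]))
    obtain ⟨p, hpP, hp⟩ := hP.exists_mem_prime_of_ne_bot hP0
    have hpPrime : (Ideal.span {p}).IsPrime := (Ideal.span_singleton_prime hp.ne_zero).2 hp
    have hle : Ideal.span {p} ≤ P := (Ideal.span_singleton_le_iff_mem P).2 hpP
    by_contra hmP
    have h₁ : (⊥ : Ideal R) < Ideal.span {p} := by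
      simpa [bot_lt_iff_ne_bot, Ideal.span_singleton_eq_bot] using hp.ne_zero
    have h₂ : Ideal.span {p} < P := by
      refine hle.lt_of_ne fun h ↦ hp.not_isUnit (hab p ?_ ?_)
      · rwa [← Ideal.mem_span_singleton, h]
      · rwa [← Ideal.mem_span_singleton, h]
    have h₃ : P < maximalIdeal R :=
      lt_of_le_not_ge (le_maximalIdeal hP.ne_top) hmP
    let s : LTSeries (PrimeSpectrum R) :=
      { length := 3
        toFun := ![⟨⊥, Ideal.isPrime_bot⟩, ⟨_, hpPrime⟩, ⟨P, hP⟩, ⟨maximalIdeal R, inferInstance⟩]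
        step := fun i ↦ by
          fin_cases i
          exacts [h₁, h₂, h₃] }
    have hs : ((3 : ℕ) : WithBot ℕ∞) ≤ ringKrullDim R := Order.LTSeries.length_le_krullDim s
    have h32 : ((3 : ℕ) : WithBot ℕ∞) ≤ ((2 : ℕ) : WithBot ℕ∞) := hs.trans hdim
    norm_cast at h32
  obtain ⟨N, hN⟩ := Ideal.exists_radical_pow_le_of_fg (Ideal.span {a, b})
    (IsNoetherian.noetherian _)
  exact ⟨N, (Ideal.pow_right_mono hrad N).trans hN⟩

/-- A square submatrix given by a selection of columns yields a right inverse up to its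
determinant. -/
theorem Matrix.mul_submatrix_one_mul_adjugate {R m n : Type*} [CommRing R] [Fintype m]
    [DecidableEq m] [Fintype n] [DecidableEq n] (A : Matrix m n R) (g : m → n) :
    A * ((1 : Matrix n n R).submatrix id g * (A.submatrix id g).adjugate) =
      (A.submatrix id g).det • 1 := by
  have h : A * (1 : Matrix n n R).submatrix id g = A.submatrix id g := by
    ext i j
    simp [Matrix.mul_apply, Matrix.one_apply]
  rw [← Matrix.mul_assoc, h, Matrix.mul_adjugate]

/-- Over a local ring, the identity plus a matrix with entries in the maximal ideal is
invertible. -/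
theorem Matrix.isUnit_one_add_of_mem_maximalIdeal {R n : Type*} [CommRing R] [IsLocalRing R]
    [Fintype n] [DecidableEq n] {C : Matrix n n R} (hC : ∀ i j, C i j ∈ maximalIdeal R) :
    IsUnit (1 + C) := by
  rw [Matrix.isUnit_iff_isUnit_det]
  refine IsUnit.of_map (residue R) _ ?_
  have h : (residue R).mapMatrix C = 0 := by
    ext i j
    simpa using hC i j
  rw [RingHom.map_det, map_add, h]
  simp

/-- Over a 2-dimensional Noetherian local UFD, if `A ∈ Mat(m,n;𝔪)` has two
maximal minors that are relatively prime, then `A` is finitely-`G_r`-determined. -/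
theorem finite_Gr_determined_of_coprime_minors
    {k R : Type*} [Field k] [CharZero k] [CommRing R] [Algebra k R]
    [IsNoetherianRing R] [IsLocalRing R] [IsDomain R] [UniqueFactorizationMonoid R]
    (hdim : ringKrullDim R = 2)
    {m n : ℕ} (hmn : m ≤ n)
    (A : Matrix (Fin m) (Fin n) R)
    (hA : ∀ i j, A i j ∈ maximalIdeal R)
    (g₁ g₂ : Fin m → Fin n) (hg₁ : Function.Injective g₁) (hg₂ : Function.Injective g₂)
    (hcoprime : ∀ d : R, d ∣ (A.submatrix id g₁).det → d ∣ (A.submatrix id g₂).det →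
      IsUnit d) :
    ∃ k₀ : ℕ, ∀ B : Matrix (Fin m) (Fin n) R,
      (∀ i j, B i j ∈ (maximalIdeal R) ^ (k₀ + 1)) →
      ∃ V : Matrix (Fin n) (Fin n) R, IsUnit V ∧ A + B = A * V := by
  obtain ⟨N, hN⟩ := exists_maximalIdeal_pow_le_span_pair hdim.le hcoprime
  refine ⟨N, fun B hB ↦ ?_⟩
  have hsplit : ∀ i j, ∃ x ∈ maximalIdeal R, ∃ y ∈ maximalIdeal R,
      x * (A.submatrix id g₁).det + y * (A.submatrix id g₂).det = B i j := by
    intro i j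
    have h : B i j ∈ maximalIdeal R *
        Ideal.span {(A.submatrix id g₁).det, (A.submatrix id g₂).det} := by
      have hij := hB i j
      rw [pow_succ'] at hij
      exact Ideal.mul_mono_right hN hij
    rw [Ideal.span_insert, Ideal.mul_sup] at h
    obtain ⟨u, hu, v, hv, huv⟩ := Submodule.mem_sup.1 h
    obtain ⟨x, hx, rfl⟩ := Ideal.mem_mul_span_singleton.1 hu
    obtain ⟨y, hy, rfl⟩ := Ideal.mem_mul_span_singleton.1 hv
    exact ⟨x, hx, y, hy, huv⟩
  choose X hX Y hY hXY using hsplit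
  have hmem : ∀ (D : Matrix (Fin n) (Fin m) R) (Z : Matrix (Fin m) (Fin n) R),
      (∀ i j, Z i j ∈ maximalIdeal R) → ∀ i j, (D * Z) i j ∈ maximalIdeal R :=
    fun D Z hZ i j ↦ Matrix.mul_apply (M := D) ▸ Ideal.sum_mem _ fun l _ ↦ Ideal.mul_mem_left _ _ (hZ l j)
  obtain ⟨D₁, hD₁⟩ : ∃ D : Matrix (Fin n) (Fin m) R, A * D = (A.submatrix id g₁).det • 1 :=
    ⟨_, A.mul_submatrix_one_mul_adjugate g₁⟩
  obtain ⟨D₂, hD₂⟩ : ∃ D : Matrix (Fin n) (Fin m) R, A * D = (A.submatrix id g₂).det • 1 :=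
    ⟨_, A.mul_submatrix_one_mul_adjugate g₂⟩
  refine ⟨1 + (D₁ * Matrix.of X + D₂ * Matrix.of Y),
    Matrix.isUnit_one_add_of_mem_maximalIdeal fun i j ↦
      Ideal.add_mem _ (hmem _ _ hX i j) (hmem _ _ hY i j), ?_⟩
  rw [Matrix.mul_add, Matrix.mul_one, Matrix.mul_add, ← Matrix.mul_assoc, ← Matrix.mul_assoc,
    hD₁, hD₂]
  ext i j
  simp [← hXY i j, mul_comm]
end

section
/- Let k be a field of characteristic zero, (R,𝔪) a Noetherian local k-algebra, and A ∈ Mat(m,m;𝔪) an upper triangular matrix. Then the following are equivalent: (i) A is finitely-G^{up}_r-determined inside upper triangular matrices; (ii) A is finitely-G^{up}_l-determined inside upper triangular matrices; (iii) A is finitely-G^{up}_{lr}-determined inside upper triangular matrices; (iv) there exists N ∈ ℕ with 𝔪^N ⊆ (det A) (the principal ideal generated by det A). -/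
open IsLocalRing

namespace Matrix

variable {R n : Type*} [CommRing R]

/-- The adjugate of an upper triangular matrix is upper triangular. -/
theorem adjugate_apply_eq_zero_of_upper
    [Fintype n] [DecidableEq n] [LinearOrder n] {A : Matrix n n R}
    (hA : ∀ i j, j < i → A i j = 0) {i j : n} (hij : j < i) : A.adjugate i j = 0 := by
  rw [adjugate_apply, det_of_isUpperTriangular]
  · exact Finset.prod_eq_zero (Finset.mem_univ j) (by simp [hij.ne])
  · intro a b hab
    have hba : b < a := hab
    rw [updateRow_apply]
    split_ifs with h
    · subst h
      simp [(hba.trans hij).ne]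
    · exact hA a b hba

theorem mul_apply_eq_zero_of_upper
    [Fintype n] [LinearOrder n] {A B : Matrix n n R}
    (hA : ∀ i j, j < i → A i j = 0) (hB : ∀ i j, j < i → B i j = 0) {i j : n} (hij : j < i) :
    (A * B) i j = 0 := by
  rw [mul_apply]
  refine Finset.sum_eq_zero fun l _ => ?_
  rcases lt_or_ge l i with h | h
  · rw [hA i l h, zero_mul]
  · rw [hB l j (hij.trans_le h), mul_zero]

theorem mul_apply_diag_of_upper
    [Fintype n] [LinearOrder n] {A B : Matrix n n R}
    (hA : ∀ i j, j < i → A i j = 0) (hB : ∀ i j, j < i → B i j = 0) (i : n) :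
    (A * B) i i = A i i * B i i := by
  rw [mul_apply]
  refine Finset.sum_eq_single i (fun l _ hl => ?_) (by simp)
  rcases lt_or_gt_of_ne hl with h | h
  · rw [hA i l h, zero_mul]
  · rw [hB l i h, mul_zero]

/-- Over a local ring, a matrix congruent to the identity modulo the maximal ideal is invertible. -/
theorem isUnit_one_add_of_mem_maximalIdeal_s12
    [Fintype n] [DecidableEq n] [IsLocalRing R] {W : Matrix n n R}
    (hW : ∀ i j, W i j ∈ maximalIdeal R) : IsUnit (1 + W) := by
  rw [isUnit_iff_isUnit_det, ← isUnit_map_iff (residue R), RingHom.map_det]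
  have h : (residue R).mapMatrix (1 + W) = 1 := by
    have hW0 : (residue R).mapMatrix W = 0 := by
      ext i j
      simpa using hW i j
    rw [map_add, map_one, hW0, add_zero]
  simp [h]

/-- An upper triangular matrix with entries in `𝔪 ^ (N + 1)`, where `𝔪 ^ N ⊆ (d)`, is `d` times an
upper triangular matrix with entries in `𝔪`. -/
theorem exists_eq_smul_of_mem_pow
    [LinearOrder n] [IsLocalRing R] {d : R} {N : ℕ}
    (hN : maximalIdeal R ^ N ≤ Ideal.span {d}) {B : Matrix n n R}
    (hB : ∀ i j, j < i → B i j = 0) (hBm : ∀ i j, B i j ∈ maximalIdeal R ^ (N + 1)) :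
    ∃ C : Matrix n n R, (∀ i j, j < i → C i j = 0) ∧ (∀ i j, C i j ∈ maximalIdeal R) ∧
      B = d • C := by
  have key (i j : n) : ∃ c ∈ maximalIdeal R, (j < i → c = 0) ∧ B i j = d * c := by
    by_cases hij : j < i
    · exact ⟨0, zero_mem _, fun _ => rfl, by simp [hB i j hij]⟩
    · have h := hBm i j
      rw [pow_succ] at h
      obtain ⟨c, hc, hcd⟩ := Ideal.mem_span_singleton_mul.1 (Ideal.mul_mono_left hN h)
      exact ⟨c, hc, fun h => absurd h hij, hcd.symm⟩
  choose C hCm hC0 hC using key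
  exact ⟨of C, hC0, hCm, by ext i j; simpa using hC i j⟩

theorem exists_upper_right_of_pow_le_det
    [Fintype n] [DecidableEq n] [LinearOrder n] [IsLocalRing R] {A : Matrix n n R}
    (hA : ∀ i j, j < i → A i j = 0) {N : ℕ} (hN : maximalIdeal R ^ N ≤ Ideal.span {A.det})
    {B : Matrix n n R} (hB : ∀ i j, j < i → B i j = 0)
    (hBm : ∀ i j, B i j ∈ maximalIdeal R ^ (N + 1)) :
    ∃ V : Matrix n n R, (∀ i j, j < i → V i j = 0) ∧ IsUnit V ∧ A + B = A * V := by
  obtain ⟨C, hC, hCm, rfl⟩ := exists_eq_smul_of_mem_pow hN hB hBm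
  refine ⟨1 + A.adjugate * C, fun i j hij => ?_, isUnit_one_add_of_mem_maximalIdeal_s12 fun i j => ?_,
    ?_⟩
  · rw [add_apply, one_apply_ne hij.ne', zero_add]
    exact mul_apply_eq_zero_of_upper (fun _ _ => adjugate_apply_eq_zero_of_upper hA) hC hij
  · exact Ideal.sum_mem _ fun l _ => Ideal.mul_mem_left _ _ (hCm l j)
  · rw [mul_add, mul_one, ← mul_assoc, mul_adjugate, smul_mul_assoc, one_mul]

theorem exists_upper_left_of_pow_le_det
    [Fintype n] [DecidableEq n] [LinearOrder n] [IsLocalRing R] {A : Matrix n n R}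
    (hA : ∀ i j, j < i → A i j = 0) {N : ℕ} (hN : maximalIdeal R ^ N ≤ Ideal.span {A.det})
    {B : Matrix n n R} (hB : ∀ i j, j < i → B i j = 0)
    (hBm : ∀ i j, B i j ∈ maximalIdeal R ^ (N + 1)) :
    ∃ U : Matrix n n R, (∀ i j, j < i → U i j = 0) ∧ IsUnit U ∧ A + B = U * A := by
  obtain ⟨C, hC, hCm, rfl⟩ := exists_eq_smul_of_mem_pow hN hB hBm
  refine ⟨1 + C * A.adjugate, fun i j hij => ?_, isUnit_one_add_of_mem_maximalIdeal_s12 fun i j => ?_,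
    ?_⟩
  · rw [add_apply, one_apply_ne hij.ne', zero_add]
    exact mul_apply_eq_zero_of_upper hC (fun _ _ => adjugate_apply_eq_zero_of_upper hA) hij
  · exact Ideal.sum_mem _ fun l _ => Ideal.mul_mem_right _ _ (hCm i l)
  · rw [add_mul, one_mul, mul_assoc, adjugate_mul, mul_smul_comm, mul_one]

/-- If every upper triangular perturbation of `A` by entries of `I` is two-sided equivalent to `A`
through upper triangular matrices, then a power of `I` lies in `(det A)`. -/
theorem pow_card_le_span_det
    [Fintype n] [DecidableEq n] [LinearOrder n] {A : Matrix n n R}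
    (hA : ∀ i j, j < i → A i j = 0) {I : Ideal R}
    (h : ∀ B : Matrix n n R, (∀ i j, j < i → B i j = 0) → (∀ i j, B i j ∈ I) →
      ∃ U V : Matrix n n R, (∀ i j, j < i → U i j = 0) ∧ (∀ i j, j < i → V i j = 0) ∧
        A + B = U * A * V) :
    I ^ Fintype.card n ≤ Ideal.span {A.det} := by
  have hdiag (i : n) : I ≤ Ideal.span {A i i} := by
    intro b hb
    obtain ⟨U, V, hU, hV, hUV⟩ := h (diagonal fun _ => b)
      (fun i j hij => diagonal_apply_ne _ hij.ne') (fun i j => by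
        rw [diagonal_apply]
        split_ifs
        exacts [hb, zero_mem _])
    have hi := congrFun (congrFun hUV i) i
    rw [mul_apply_diag_of_upper (fun _ _ => mul_apply_eq_zero_of_upper hU hA) hV,
      mul_apply_diag_of_upper hU hA, add_apply, diagonal_apply_eq] at hi
    rw [Ideal.mem_span_singleton]
    exact ⟨U i i * V i i - 1, by linear_combination hi⟩
  rw [det_of_isUpperTriangular (fun i j hij => hA i j hij), ← Ideal.prod_span_singleton,
    ← Finset.card_univ, ← Finset.prod_const]
  exact Finset.prod_le_prod' fun i _ => hdiag i

end Matrix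

/-- For an upper triangular `A ∈ Mat(m,m;𝔪)`, the following are
equivalent: finite `G^{up}_r`-determinacy, finite `G^{up}_l`-determinacy, finite
`G^{up}_{lr}`-determinacy (all inside upper triangular matrices), and
`𝔪^N ⊆ (det A)` for some `N`. -/
theorem finite_Gup_determined_iff_pow_le_det
    {k R : Type*} [Field k] [CharZero k] [CommRing R] [Algebra k R]
    [IsNoetherianRing R] [IsLocalRing R]
    {m : ℕ}
    (A : Matrix (Fin m) (Fin m) R)
    (hup : ∀ i j : Fin m, j < i → A i j = 0)
    (hA : ∀ i j, A i j ∈ maximalIdeal R) :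
    ((∃ k₀ : ℕ, ∀ B : Matrix (Fin m) (Fin m) R,
        (∀ i j : Fin m, j < i → B i j = 0) →
        (∀ i j, B i j ∈ (maximalIdeal R) ^ (k₀ + 1)) →
        ∃ V : Matrix (Fin m) (Fin m) R,
          (∀ i j : Fin m, j < i → V i j = 0) ∧ IsUnit V ∧ A + B = A * V) ↔
      (∃ N : ℕ, (maximalIdeal R) ^ N ≤ Ideal.span {A.det})) ∧
    ((∃ k₀ : ℕ, ∀ B : Matrix (Fin m) (Fin m) R,
        (∀ i j : Fin m, j < i → B i j = 0) →
        (∀ i j, B i j ∈ (maximalIdeal R) ^ (k₀ + 1)) →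
        ∃ U : Matrix (Fin m) (Fin m) R,
          (∀ i j : Fin m, j < i → U i j = 0) ∧ IsUnit U ∧ A + B = U * A) ↔
      (∃ N : ℕ, (maximalIdeal R) ^ N ≤ Ideal.span {A.det})) ∧
    ((∃ k₀ : ℕ, ∀ B : Matrix (Fin m) (Fin m) R,
        (∀ i j : Fin m, j < i → B i j = 0) →
        (∀ i j, B i j ∈ (maximalIdeal R) ^ (k₀ + 1)) →
        ∃ (U V : Matrix (Fin m) (Fin m) R),
          (∀ i j : Fin m, j < i → U i j = 0) ∧ (∀ i j : Fin m, j < i → V i j = 0) ∧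
          IsUnit U ∧ IsUnit V ∧ A + B = U * A * V) ↔
      (∃ N : ℕ, (maximalIdeal R) ^ N ≤ Ideal.span {A.det})) := by
  have of_lr (k₀ : ℕ) (h : ∀ B : Matrix (Fin m) (Fin m) R,
      (∀ i j : Fin m, j < i → B i j = 0) →
      (∀ i j, B i j ∈ (maximalIdeal R) ^ (k₀ + 1)) →
      ∃ U V : Matrix (Fin m) (Fin m) R, (∀ i j : Fin m, j < i → U i j = 0) ∧
        (∀ i j : Fin m, j < i → V i j = 0) ∧ A + B = U * A * V) :
      ∃ N : ℕ, (maximalIdeal R) ^ N ≤ Ideal.span {A.det} :=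
    ⟨(k₀ + 1) * Fintype.card (Fin m), by
      rw [pow_mul]
      exact Matrix.pow_card_le_span_det hup h⟩
  have one_upper (i j : Fin m) (hij : j < i) : (1 : Matrix (Fin m) (Fin m) R) i j = 0 :=
    Matrix.one_apply_ne hij.ne'
  refine ⟨⟨?_, ?_⟩, ⟨?_, ?_⟩, ⟨?_, ?_⟩⟩
  · rintro ⟨k₀, h⟩
    refine of_lr k₀ fun B hB hBm => ?_
    obtain ⟨V, hV, -, hAV⟩ := h B hB hBm
    exact ⟨1, V, one_upper, hV, by rw [one_mul, hAV]⟩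
  · rintro ⟨N, hN⟩
    exact ⟨N, fun B hB hBm => Matrix.exists_upper_right_of_pow_le_det hup hN hB hBm⟩
  · rintro ⟨k₀, h⟩
    refine of_lr k₀ fun B hB hBm => ?_
    obtain ⟨U, hU, -, hUA⟩ := h B hB hBm
    exact ⟨U, 1, hU, one_upper, by rw [mul_one, hUA]⟩
  · rintro ⟨N, hN⟩
    exact ⟨N, fun B hB hBm => Matrix.exists_upper_left_of_pow_le_det hup hN hB hBm⟩
  · rintro ⟨k₀, h⟩
    refine of_lr k₀ fun B hB hBm => ?_
    obtain ⟨U, V, hU, hV, -, -, hUV⟩ := h B hB hBm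
    exact ⟨U, V, hU, hV, hUV⟩
  · rintro ⟨N, hN⟩
    refine ⟨N, fun B hB hBm => ?_⟩
    obtain ⟨V, hV, hVu, hAV⟩ := Matrix.exists_upper_right_of_pow_le_det hup hN hB hBm
    exact ⟨1, V, one_upper, hV, isUnit_one, hVu, by rw [one_mul, hAV]⟩
end
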